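/- arXiv:math-ph/0611029 — 4 statements merged into one kernel-verified Lean document; each statement's English description precedes it below -/
import Mathlib

section
/- Let d : ℤ × ℤ → ℂ be a function satisfying, for all n, m ∈ ℤ, the four recursion relations (i) d(n+1,m) = 2·d(n,m) − d(n−1,m), (ii) d(n+1,m) − d(n,m) = d(n+1,m−1) − d(n,m−1), (iii) d(n,m+1) − d(n,m) = d(n−1,m+1) − d(n−1,m), and (iv) d(n,m+1) = 2·d(n,m) − d(n,m−1). Then there exist complex constants τ₁, τ₂, ε such that d(n,m) = τ₁·n + τ₂·m + ε for all n, m ∈ ℤ. -/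
/-- A two-sided sequence whose second differences vanish is affine. -/
theorem Int.eq_affine_of_second_difference_eq_zero {R : Type*} [CommRing R] (f : ℤ → R)
    (h : ∀ n, f (n + 1) = 2 * f n - f (n - 1)) (n : ℤ) :
    f n = (f 1 - f 0) * n + f 0 := by
  suffices H : f n = (f 1 - f 0) * n + f 0 ∧ f (n + 1) = (f 1 - f 0) * (n + 1) + f 0 from H.1
  induction n using Int.induction_on with
  | zero => simp
  | succ k ih =>
    obtain ⟨ha, hb⟩ := ih
    have hk := h (k + 1)
    rw [add_sub_cancel_right] at hk
    push_cast at *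
    exact ⟨hb, by linear_combination hk + 2 * hb - ha⟩
  | pred k ih =>
    obtain ⟨ha, hb⟩ := ih
    have hk := h (-k)
    rw [sub_add_cancel]
    push_cast at *
    exact ⟨by linear_combination 2 * ha - hb + hk, by linear_combination ha⟩

/-- Solution of the order-one recursion relations on the noncommutative torus:
any `d : ℤ × ℤ → ℂ` satisfying the four recursion relations is affine. -/
theorem stmt_0 (d : ℤ × ℤ → ℂ)
    (h1 : ∀ n m : ℤ, d (n + 1, m) = 2 * d (n, m) - d (n - 1, m))
    (h2 : ∀ n m : ℤ, d (n + 1, m) - d (n, m) = d (n + 1, m - 1) - d (n, m - 1))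
    (h3 : ∀ n m : ℤ, d (n, m + 1) - d (n, m) = d (n - 1, m + 1) - d (n - 1, m))
    (h4 : ∀ n m : ℤ, d (n, m + 1) = 2 * d (n, m) - d (n, m - 1)) :
    ∃ τ₁ τ₂ ε : ℂ, ∀ n m : ℤ, d (n, m) = τ₁ * n + τ₂ * m + ε := by
  have row (n m : ℤ) : d (n, m) = (d (1, m) - d (0, m)) * n + d (0, m) :=
    Int.eq_affine_of_second_difference_eq_zero (fun k => d (k, m)) (fun k => h1 k m) n
  have col (n m : ℤ) : d (n, m) = (d (n, 1) - d (n, 0)) * m + d (n, 0) :=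
    Int.eq_affine_of_second_difference_eq_zero (fun k => d (n, k)) (fun k => h4 n k) m
  have cross : d (1, 1) - d (0, 1) = d (1, 0) - d (0, 0) := by simpa using h2 0 1
  refine ⟨d (1, 0) - d (0, 0), d (0, 1) - d (0, 0), d (0, 0), fun n m => ?_⟩
  linear_combination col n m + m * row n 1 + (1 - m) * row n 0 + m * n * cross
end

section
/- Let a, b, c, d be real numbers. Then the following are equivalent: (1) a·d ≠ b·c; (2) for every real Λ, the set {(n,m) ∈ ℤ × ℤ : (a·n + b·m)² + (c·n + d·m)² ≤ Λ} is finite. -/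
theorem finite_setOf_mul_intCast_sq_le {D : ℝ} (hD : D ≠ 0) (K : ℝ) :
    {n : ℤ | (D * n) ^ 2 ≤ K}.Finite := by
  refine (Set.finite_Icc (-⌈K / D ^ 2⌉) ⌈K / D ^ 2⌉).subset fun n hn => ?_
  have hD2 : 0 < D ^ 2 := by positivity
  have hn2 : (n : ℝ) ^ 2 ≤ K / D ^ 2 := by
    rw [le_div_iff₀ hD2, mul_comm, ← mul_pow]
    exact hn
  have h : n ^ 2 ≤ ⌈K / D ^ 2⌉ := by exact_mod_cast hn2.trans (Int.le_ceil _)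
  exact abs_le.mp ((Int.natCast_natAbs n ▸ Int.natAbs_le_self_sq n).trans h)

theorem finite_sublevel_of_det_ne_zero {a b c d : ℝ} (h : a * d ≠ b * c) (Λ : ℝ) :
    {p : ℤ × ℤ | (a * p.1 + b * p.2) ^ 2 + (c * p.1 + d * p.2) ^ 2 ≤ Λ}.Finite := by
  have hD : a * d - b * c ≠ 0 := sub_ne_zero.mpr h
  refine ((finite_setOf_mul_intCast_sq_le hD ((b ^ 2 + d ^ 2) * Λ)).prod
    (finite_setOf_mul_intCast_sq_le hD ((a ^ 2 + c ^ 2) * Λ))).subset ?_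
  rintro ⟨n, m⟩ hp
  simp only [Set.mem_ofPred_eq] at hp
  refine ⟨?_, ?_⟩ <;> simp only [Set.mem_ofPred_eq]
  · have := mul_le_mul_of_nonneg_left hp (by positivity : 0 ≤ b ^ 2 + d ^ 2)
    nlinarith [sq_nonneg (b * (a * n + b * m) + d * (c * n + d * m))]
  · have := mul_le_mul_of_nonneg_left hp (by positivity : 0 ≤ a ^ 2 + c ^ 2)
    nlinarith [sq_nonneg (a * (a * n + b * m) + c * (c * n + d * m))]

theorem infinite_sublevel_of_smul_columns (a c x : ℝ) :
    {p : ℤ × ℤ | (a * p.1 + -(a * x) * p.2) ^ 2 + (c * p.1 + -(c * x) * p.2) ^ 2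
      ≤ a ^ 2 + c ^ 2}.Infinite := by
  refine Set.infinite_of_injective_forall_mem (f := fun m : ℤ => (⌊m * x⌋, m))
    (fun m k h => congrArg Prod.snd h) fun m => ?_
  simp only [Set.mem_ofPred_eq]
  have h0 := Int.fract_nonneg ((m : ℝ) * x)
  have h1 := (Int.fract_lt_one ((m : ℝ) * x)).le
  have h2 : Int.fract ((m : ℝ) * x) ^ 2 ≤ 1 := pow_le_one₀ h0 h1
  have h3 : (⌊(m : ℝ) * x⌋ : ℝ) = m * x - Int.fract ((m : ℝ) * x) := by
    rw [Int.self_sub_fract]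
  rw [h3]
  nlinarith [mul_le_mul_of_nonneg_left h2 (by positivity : 0 ≤ a ^ 2 + c ^ 2)]

/-- Compactness of the resolvent of `⟨D⟩` on the noncommutative torus:
`a·d ≠ b·c` iff every sublevel set of the quadratic form
`(a n + b m)² + (c n + d m)²` on the lattice `ℤ²` is finite. -/
theorem stmt_2 (a b c d : ℝ) :
    a * d ≠ b * c ↔
      ∀ Λ : ℝ,
        {p : ℤ × ℤ |
          (a * p.1 + b * p.2) ^ 2 + (c * p.1 + d * p.2) ^ 2 ≤ Λ}.Finite := by
  refine ⟨finite_sublevel_of_det_ne_zero, fun hfin h => ?_⟩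
  have key : ∀ x : ℝ, b = -(a * x) → d = -(c * x) → False := by
    rintro x rfl rfl
    exact infinite_sublevel_of_smul_columns a c x (hfin _)
  by_cases ha : a = 0
  · by_cases hc : c = 0
    · subst ha hc
      refine Set.infinite_of_injective_forall_mem (f := fun n : ℤ => (n, (0 : ℤ)))
        (fun m k h => congrArg Prod.fst h) (fun n => ?_) (hfin 0)
      simp
    · refine key (-d / c) ?_ ?_ <;> field_simp <;> linarith
  · refine key (-b / a) ?_ ?_ <;> field_simp <;> linarith
end

section
/- Let a, b, c, d be real numbers and let g be the real symmetric 2×2 matrix −[[a·c, (b·c + a·d)/2], [(b·c + a·d)/2, b·d]]. Then det(g) = −(b·c − a·d)²/4. In particular, if a·d ≠ b·c then det(g) < 0 and there exist vectors u, v ∈ ℝ² with uᵀ·g·u > 0 and vᵀ·g·v < 0, i.e. g has one positive and one negative eigenvalue. -/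
open Matrix

/-- The metric induced by an equivariant Dirac operator on the commutative
torus: the matrix `g = -[[a c, (b c + a d)/2], [(b c + a d)/2, b d]]` has
determinant `-(b c - a d)²/4`; if `a d ≠ b c` then `det g < 0` and `g` takes
both positive and negative values as a quadratic form, i.e. it has one
positive and one negative eigenvalue (Lorentzian signature). -/
theorem stmt_6 (a b c d : ℝ)
    (g : Matrix (Fin 2) (Fin 2) ℝ)
    (hg : g = -!![a * c, (b * c + a * d) / 2;
                  (b * c + a * d) / 2, b * d]) :
    g.det = -(b * c - a * d) ^ 2 / 4 ∧
    (a * d ≠ b * c →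
      g.det < 0 ∧
      ∃ u v : Fin 2 → ℝ,
        0 < u ⬝ᵥ g.mulVec u ∧ v ⬝ᵥ g.mulVec v < 0) := by
  have hdet : g.det = -(b * c - a * d) ^ 2 / 4 := by
    subst hg
    simp only [Matrix.det_fin_two, Matrix.neg_apply, Matrix.of_apply, Matrix.cons_val',
      Matrix.cons_val_zero, Matrix.cons_val_one, Matrix.cons_val_fin_one]
    ring
  have hquad (x y : ℝ) :
      ![x, y] ⬝ᵥ g.mulVec ![x, y] = -((a * x + b * y) * (c * x + d * y)) := by
    subst hg
    simp [Matrix.mulVec, dotProduct, Fin.sum_univ_two]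
    ring
  refine ⟨hdet, fun h => ?_⟩
  have hpos : 0 < (b * c - a * d) ^ 2 := by
    have := sub_ne_zero.mpr h.symm
    positivity
  refine ⟨by rw [hdet]; linarith, ![d + b, -c - a], ![d - b, a - c], ?_, ?_⟩
  · rw [hquad]
    linarith
  · rw [hquad]
    linarith
end

section
/- Let R, S be real numbers. Then the following are equivalent: (1) R ≠ 0 and S ≠ 0; (2) for every real Λ, the set {(p,s) ∈ ℕ × ℕ : R²·(s−p)² + 4·S²·p·(s+1) ≤ Λ} is finite. -/
/-- The quadratic form dominates `min (R²) (S²) * (s + p)²`. -/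
theorem min_sq_mul_add_sq_le (R S : ℝ) (p s : ℕ) :
    min (R ^ 2) (S ^ 2) * ((s : ℝ) + p) ^ 2 ≤
      R ^ 2 * ((s : ℝ) - p) ^ 2 + 4 * S ^ 2 * (p : ℝ) * ((s : ℝ) + 1) := by
  have hR := mul_le_mul_of_nonneg_right (min_le_left (R ^ 2) (S ^ 2)) (sq_nonneg ((s : ℝ) - p))
  have hS := mul_le_mul_of_nonneg_right (min_le_right (R ^ 2) (S ^ 2))
    (by positivity : 0 ≤ 4 * ((p : ℝ) * s))
  have hp : 0 ≤ 4 * S ^ 2 * (p : ℝ) := by positivity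
  linarith

/-- Compactness of the resolvent of `⟨D⟩` on the isospectral noncommutative
3-sphere: `R ≠ 0 ∧ S ≠ 0` iff every sublevel set of
`R²(s−p)² + 4S²p(s+1)` on `ℕ × ℕ` is finite. -/
theorem stmt_13 (R S : ℝ) :
    (R ≠ 0 ∧ S ≠ 0) ↔
      ∀ Λ : ℝ,
        {ps : ℕ × ℕ |
          R ^ 2 * ((ps.2 : ℝ) - (ps.1 : ℝ)) ^ 2
            + 4 * S ^ 2 * (ps.1 : ℝ) * ((ps.2 : ℝ) + 1) ≤ Λ}.Finite := by
  constructor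
  · rintro ⟨hR, hS⟩ Λ
    have hc : 0 < min (R ^ 2) (S ^ 2) := lt_min (by positivity) (by positivity)
    obtain ⟨n, hn⟩ := exists_nat_ge (Λ / min (R ^ 2) (S ^ 2))
    refine (Set.finite_Iic (n, n)).subset ?_
    rintro ⟨p, s⟩ (h : _ ≤ Λ)
    have hle : ((s : ℝ) + p) ^ 2 ≤ n :=
      ((le_div_iff₀' hc).2 ((min_sq_mul_add_sq_le R S p s).trans h)).trans hn
    have hle' : (s + p) ^ 2 ≤ n := mod_cast hle
    have hsq : s + p ≤ (s + p) ^ 2 := Nat.le_self_pow two_ne_zero _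
    exact ⟨show p ≤ n by lia, show s ≤ n by lia⟩
  · intro h
    constructor
    · rintro rfl
      refine Set.infinite_range_of_injective (f := fun s : ℕ ↦ ((0 : ℕ), s))
        (fun a b hab ↦ (Prod.ext_iff.1 hab).2) ((h 0).subset ?_)
      rintro _ ⟨s, rfl⟩
      simp
    · rintro rfl
      refine Set.infinite_range_of_injective (f := fun s : ℕ ↦ (s, s))
        (fun a b hab ↦ (Prod.ext_iff.1 hab).2) ((h 0).subset ?_)
      rintro _ ⟨s, rfl⟩
      simp
end
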